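/- For every n ≥ 1 there exist a unitary matrix U ∈ M_{2ⁿ}(ℂ) and a bijection e between the index type Σ_{r=0}^{⌊n/2⌋} Fin(n−2r+1) × Fin(m_r), where m_r = C(n,r) − C(n,r−1) (with C(n,−1) = 0), and the type Fin n → Fin 2 of n-bit strings, such that for every 2×2 complex matrix X, conjugating the n-fold tensor power X^{⊗n} (the matrix with entries X^{⊗n}(s,t) = ∏_{i<n} X(s(i),t(i))) by U and reindexing along e yields the block-diagonal matrix whose block at multiplicity index (r, c) equals (det X)^r • S_{n−2r}(X) for every c ∈ Fin(m_r). In particular Σ_{r=0}^{⌊n/2⌋} (n−2r+1)·(C(n,r) − C(n,r−1)) = 2ⁿ. -/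

import Mathlib

open Matrix BigOperators

noncomputable section

/-- The matrix `S_m(A)` of the `m`-th symmetric power representation of `GL(2)`. -/
def Sm (m : ℕ) (A : Matrix (Fin 2) (Fin 2) ℂ) :
    Matrix (Fin (m + 1)) (Fin (m + 1)) ℂ :=
  Matrix.of fun k j =>
    (Real.sqrt ((Nat.factorial (k : ℕ) * Nat.factorial (m - (k : ℕ)) : ℝ) /
        (Nat.factorial (j : ℕ) * Nat.factorial (m - (j : ℕ)))) : ℂ) *
    ∑ p ∈ Finset.Icc ((k : ℕ) - (m - (j : ℕ))) (min (k : ℕ) (j : ℕ)),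
      (Nat.choose (j : ℕ) p : ℂ) * (Nat.choose (m - (j : ℕ)) ((k : ℕ) - p) : ℂ) *
        A 0 0 ^ p * A 1 0 ^ ((j : ℕ) - p) * A 0 1 ^ ((k : ℕ) - p) *
        A 1 1 ^ ((m - (j : ℕ)) - ((k : ℕ) - p))

/-- Multiplicity `C(n,r) - C(n,r-1)` (with `C(n,-1) = 0`). -/
def mult (n r : ℕ) : ℕ := n.choose r - if r = 0 then 0 else n.choose (r - 1)

/-- The n-fold tensor power of a `2×2` matrix, indexed by bit strings. -/
def tensorPow (n : ℕ) (X : Matrix (Fin 2) (Fin 2) ℂ) :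
    Matrix (Fin n → Fin 2) (Fin n → Fin 2) ℂ :=
  Matrix.of fun s t => ∏ i, X (s i) (t i)

/-- Index type of the Schur-Weyl decomposition of `(ℂ²)^{⊗n}`: a two-row partition
`(n-r, r)`, a basis index of the `GL(2)`-irrep, and a multiplicity index. -/
def SWIndex (n : ℕ) :=
  Σ r : Fin (n / 2 + 1), Fin (n - 2 * (r : ℕ) + 1) × Fin (mult n (r : ℕ))

/-- The block-diagonal matrix with block `(det X)^r • S_{n-2r}(X)` at each multiplicity
index of the partition `(n-r, r)`. -/
def blockMat (n : ℕ) (X : Matrix (Fin 2) (Fin 2) ℂ) : Matrix (SWIndex n) (SWIndex n) ℂ :=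
  fun p q =>
    if h : p.1 = q.1 then
      if (p.2.2 : ℕ) = (q.2.2 : ℕ) then
        X.det ^ (p.1 : ℕ) *
          Sm (n - 2 * (p.1 : ℕ)) X p.2.1 (Fin.cast (by rw [h]) q.2.1)
      else 0
    else 0


open Polynomial in
/-- Unnormalized matrix coefficients of the symmetric power. -/
def Tm (A : Matrix (Fin 2) (Fin 2) ℂ) (m k l : ℕ) : ℂ :=
  ((C (A 0 0) * X + C (A 1 0)) ^ l * (C (A 0 1) * X + C (A 1 1)) ^ (m - l) : ℂ[X]).coeff k

open Polynomial in
lemma coeff_lin_pow (a c : ℂ) (j p : ℕ) :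
    ((C a * X + C c) ^ j : ℂ[X]).coeff p = (j.choose p : ℂ) * a ^ p * c ^ (j - p) := by
  rw [add_pow, finsetSum_coeff]
  have : ∀ x ∈ Finset.range (j + 1),
      ((C a * X) ^ x * C c ^ (j - x) * ((j.choose x : ℕ) : ℂ[X])).coeff p
        = if x = p then (j.choose x : ℂ) * a ^ x * c ^ (j - x) else 0 := by
    intro x _
    have e : ((C a * X) ^ x * C c ^ (j - x) * ((j.choose x : ℕ) : ℂ[X]))
        = C (a ^ x * c ^ (j - x) * (j.choose x : ℂ)) * X ^ x := by
      simp only [map_mul, map_pow, map_natCast]; ring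
    rw [e, coeff_C_mul_X_pow]
    by_cases hx : x = p
    · subst hx; simp; ring
    · rw [if_neg hx, if_neg (fun h => hx h.symm)]
  rw [Finset.sum_congr rfl this, Finset.sum_ite_eq']
  split_ifs with hp
  · rfl
  · rw [Nat.choose_eq_zero_of_lt (by simpa using hp)]; simp

lemma Sm_eq (m : ℕ) (A : Matrix (Fin 2) (Fin 2) ℂ) (k j : Fin (m + 1)) :
    Sm m A k j = (Real.sqrt ((Nat.factorial (k : ℕ) * Nat.factorial (m - (k : ℕ)) : ℝ) /
        (Nat.factorial (j : ℕ) * Nat.factorial (m - (j : ℕ)))) : ℂ) * Tm A m k j := by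
  unfold Sm Tm
  simp only [Matrix.of_apply]
  congr 1
  rw [Polynomial.coeff_mul, Finset.Nat.sum_antidiagonal_eq_sum_range_succ_mk]
  simp only [coeff_lin_pow]
  have hsub : Finset.Icc ((k : ℕ) - (m - (j : ℕ))) (min (k : ℕ) (j : ℕ)) ⊆
      Finset.range (k : ℕ).succ := by
    intro p hp
    simp only [Finset.mem_Icc, Finset.mem_range] at *
    omega
  rw [← Finset.sum_subset hsub]
  · refine Finset.sum_congr rfl fun p _ => ?_
    ring
  · intro p hp hp2
    simp only [Finset.mem_Icc, Finset.mem_range, not_and_or, not_le] at *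
    rcases hp2 with h | h
    · rw [Nat.choose_eq_zero_of_lt (n := m - (j : ℕ)) (by omega)]; simp
    · rw [Nat.choose_eq_zero_of_lt (n := (j : ℕ)) (by omega)]; simp

open Polynomial in
lemma Tm_zero (A : Matrix (Fin 2) (Fin 2) ℂ) (m k l : ℕ) (hl : l ≤ m) (hk : m < k) :
    Tm A m k l = 0 := by
  unfold Tm
  apply coeff_eq_zero_of_natDegree_lt
  have h1 : ∀ (a c : ℂ) (j : ℕ), ((C a * X + C c) ^ j : ℂ[X]).natDegree ≤ j := fun a c j => by
    refine natDegree_pow_le_of_le (m := 1) j natDegree_linear_le |>.trans (by omega)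
  have := natDegree_mul_le_of_le (h1 (A 0 0) (A 1 0) l) (h1 (A 0 1) (A 1 1) (m - l))
  omega

open Polynomial in
/-- The derivative identity. -/
lemma Tm_V0 (A : Matrix (Fin 2) (Fin 2) ℂ) (m k l : ℕ) (hl : l ≤ m + 1) :
    (l : ℂ) * Tm A m k (l - 1) * A 0 0 + ((m + 1 - l : ℕ) : ℂ) * Tm A m k l * A 0 1
      = ((k : ℂ) + 1) * Tm A (m + 1) (k + 1) l := by
  unfold Tm
  rw [mul_comm ((k : ℂ) + 1), ← coeff_derivative]
  have h : derivative ((C (A 0 0) * X + C (A 1 0)) ^ l *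
        (C (A 0 1) * X + C (A 1 1)) ^ (m + 1 - l) : ℂ[X])
      = C ((l : ℂ) * A 0 0) * ((C (A 0 0) * X + C (A 1 0)) ^ (l - 1) *
        (C (A 0 1) * X + C (A 1 1)) ^ (m - (l - 1)))
      + C (((m + 1 - l : ℕ) : ℂ) * A 0 1) * ((C (A 0 0) * X + C (A 1 0)) ^ l *
        (C (A 0 1) * X + C (A 1 1)) ^ (m - l)) := by
    rw [derivative_mul, derivative_pow, derivative_pow]
    simp only [derivative_add, derivative_mul, derivative_C, derivative_X, map_mul]
    rw [show m + 1 - l - 1 = m - l by omega]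
    rcases Nat.eq_zero_or_pos l with h0 | h0
    · subst h0; simp; ring
    · rw [show m - (l - 1) = m + 1 - l by omega]
      simp only [map_natCast]; ring
  rw [h, coeff_add, coeff_C_mul, coeff_C_mul]
  ring

open Polynomial in
lemma Tm_euler (A : Matrix (Fin 2) (Fin 2) ℂ) (m l : ℕ) (hl : l ≤ m + 1) :
    C (l : ℂ) * ((C (A 0 0) * X + C (A 1 0)) ^ (l - 1) *
        (C (A 0 1) * X + C (A 1 1)) ^ (m - (l - 1))) * (C (A 0 0) * X + C (A 1 0))
      + C ((m + 1 - l : ℕ) : ℂ) * ((C (A 0 0) * X + C (A 1 0)) ^ l *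
        (C (A 0 1) * X + C (A 1 1)) ^ (m - l)) * (C (A 0 1) * X + C (A 1 1))
     = C ((m + 1 : ℕ) : ℂ) * ((C (A 0 0) * X + C (A 1 0)) ^ l *
        (C (A 0 1) * X + C (A 1 1)) ^ (m + 1 - l) : ℂ[X]) := by
  rcases Nat.eq_zero_or_pos l with h0 | h0
  · subst h0; simp; ring
  · obtain ⟨l, rfl⟩ : ∃ l', l = l' + 1 := ⟨l - 1, by omega⟩
    obtain ⟨q, rfl⟩ : ∃ q, m = l + q := ⟨m - l, by omega⟩
    rw [show l + q + 1 - (l + 1) = q by omega, show l + 1 - 1 = l by omega,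
      show l + q - l = q by omega, show l + q - (l + 1) = q - 1 by omega]
    rcases Nat.eq_zero_or_pos q with h1 | h1
    · subst h1; simp; ring
    · obtain ⟨q, rfl⟩ : ∃ q', q = q' + 1 := ⟨q - 1, by omega⟩
      simp only [Nat.add_sub_cancel, map_natCast]; push_cast; ring

open Polynomial in
lemma coeff_mul_lin (P : ℂ[X]) (a c : ℂ) (k : ℕ) :
    (P * (C a * X + C c)).coeff k = (if k = 0 then 0 else P.coeff (k - 1)) * a + P.coeff k * c := by
  rw [mul_add, coeff_add, coeff_mul_C, show P * (C a * X) = (P * C a) * X by ring]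
  cases k with
  | zero => simp
  | succ k => simp [coeff_mul_X]

lemma Tm_V1 (A : Matrix (Fin 2) (Fin 2) ℂ) (m k l : ℕ) (hl : l ≤ m + 1) (hk : k ≤ m + 1) :
    (l : ℂ) * Tm A m k (l - 1) * A 1 0 + ((m + 1 - l : ℕ) : ℂ) * Tm A m k l * A 1 1
      = ((m + 1 - k : ℕ) : ℂ) * Tm A (m + 1) k l := by
  have h := congrArg (fun P => Polynomial.coeff P k) (Tm_euler A m l hl)
  simp only [Polynomial.coeff_add, coeff_mul_lin, Polynomial.coeff_C_mul] at h
  have h0 := Tm_V0 A m (k - 1) l hl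
  unfold Tm at *
  rw [Nat.cast_sub hk]
  cases k with
  | zero => simp at h h0 ⊢; linear_combination h
  | succ k =>
    simp at h h0 ⊢; linear_combination h - h0

open Polynomial in
lemma Tm_W_poly (A : Matrix (Fin 2) (Fin 2) ℂ) (m l k : ℕ) (hl : l ≤ m) :
    Tm A (m + 1) k l = (if k = 0 then 0 else Tm A m (k - 1) l) * A 0 1 + Tm A m k l * A 1 1 := by
  unfold Tm
  rw [← coeff_mul_lin, show m + 1 - l = (m - l) + 1 by omega, pow_succ, mul_assoc]

open Polynomial in
lemma Tm_W_poly2 (A : Matrix (Fin 2) (Fin 2) ℂ) (m l k : ℕ) (hl : l ≤ m) :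
    Tm A (m + 1) k (l + 1)
      = (if k = 0 then 0 else Tm A m (k - 1) l) * A 0 0 + Tm A m k l * A 1 0 := by
  unfold Tm
  rw [← coeff_mul_lin, show m + 1 - (l + 1) = (m - l) by omega, pow_succ]
  congr 1; ring

lemma Tm_W0 (A : Matrix (Fin 2) (Fin 2) ℂ) (m k l : ℕ) (hl : l ≤ m) :
    Tm A (m + 1) k l * A 0 0 - Tm A (m + 1) k (l + 1) * A 0 1 = A.det * Tm A m k l := by
  rw [Tm_W_poly A m l k hl, Tm_W_poly2 A m l k hl, Matrix.det_fin_two]; ring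

lemma Tm_W1 (A : Matrix (Fin 2) (Fin 2) ℂ) (m k l : ℕ) (hl : l ≤ m) :
    Tm A (m + 1) k l * A 1 0 - Tm A (m + 1) k (l + 1) * A 1 1 =
      - (A.det * (if k = 0 then 0 else Tm A m (k - 1) l)) := by
  rw [Tm_W_poly A m l k hl, Tm_W_poly2 A m l k hl, Matrix.det_fin_two]; ring

/-- one extra tensor factor: vector with the two components. -/
def consVec {n : ℕ} (u v : (Fin n → Fin 2) → ℂ) (s : Fin (n + 1) → Fin 2) : ℂ :=
  if s 0 = 0 then u (Fin.tail s) else v (Fin.tail s)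

lemma sum_cons {n : ℕ} (F : (Fin (n + 1) → Fin 2) → ℂ) :
    ∑ s, F s = ∑ s : Fin n → Fin 2, F (Fin.cons 0 s) + ∑ s : Fin n → Fin 2, F (Fin.cons 1 s) := by
  rw [← (Fin.consEquiv (fun _ : Fin (n + 1) => Fin 2)).sum_comp, Fintype.sum_prod_type,
    Fin.sum_univ_two]
  rfl

@[simp] lemma consVec_zero {n : ℕ} (u v : (Fin n → Fin 2) → ℂ) (s : Fin n → Fin 2) :
    consVec u v (Fin.cons 0 s) = u s := by simp [consVec]

@[simp] lemma consVec_one {n : ℕ} (u v : (Fin n → Fin 2) → ℂ) (s : Fin n → Fin 2) :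
    consVec u v (Fin.cons 1 s) = v s := by simp [consVec]

lemma consVec_inner {n : ℕ} (u v u' v' : (Fin n → Fin 2) → ℂ) :
    ∑ s, consVec u v s * consVec u' v' s = ∑ s, u s * u' s + ∑ s, v s * v' s := by
  rw [sum_cons]; simp

lemma tensorPow_cons {n : ℕ} (X : Matrix (Fin 2) (Fin 2) ℂ) (b b' : Fin 2) (s t : Fin n → Fin 2) :
    tensorPow (n + 1) X (Fin.cons b s : Fin (n + 1) → Fin 2) (Fin.cons b' t : Fin (n + 1) → Fin 2)
      = X b b' * tensorPow n X s t := by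
  simp [tensorPow, Fin.prod_univ_succ]

lemma tensorPow_consVec {n : ℕ} (X : Matrix (Fin 2) (Fin 2) ℂ) (b : Fin 2) (s : Fin n → Fin 2)
    (u v : (Fin n → Fin 2) → ℂ) :
    ∑ t, tensorPow (n + 1) X (Fin.cons b s : Fin (n + 1) → Fin 2) t * consVec u v t
      = X b 0 * ∑ t, tensorPow n X s t * u t + X b 1 * ∑ t, tensorPow n X s t * v t := by
  rw [sum_cons]
  simp only [tensorPow_cons, consVec_zero, consVec_one, Finset.mul_sum, mul_assoc]

lemma mult_succ (n s : ℕ) (h : 2 * s + 2 ≤ n + 1) :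
    mult (n + 1) (s + 1) = mult n (s + 1) + mult n s := by
  have h1 : n.choose s ≤ n.choose (s + 1) := by
    rcases Nat.lt_or_ge s (n / 2) with h' | h'
    · exact Nat.choose_le_succ_of_lt_half_left h'
    · have : n = 2 * s + 1 := by omega
      subst this
      rw [Nat.choose_symm_half]
  unfold mult
  cases s with
  | zero => simp at *; omega
  | succ s =>
    have h2 : n.choose s ≤ n.choose (s + 1) :=
      Nat.choose_le_succ_of_lt_half_left (by omega)
    simp [Nat.choose_succ_succ] at *
    omega

lemma mult_half (s : ℕ) : mult (2 * s + 1) (s + 1) = 0 := by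
  unfold mult
  simp [Nat.choose_symm_half]

lemma mult_zero' (n : ℕ) : mult n 0 = 1 := by simp [mult]

/-- Data of an orthogonal decomposition of the tensor power into symmetric powers. -/
structure SWData (n : ℕ) (ι : Type) [Fintype ι] where
  r : ι → ℕ
  m : ι → ℕ
  c : ι → ℕ
  h : ι → ℕ → (Fin n → Fin 2) → ℂ
  hm : ∀ i, 2 * r i + m i = n
  hc : ∀ i, 0 < c i
  real : ∀ i k s, star (h i k s) = h i k s
  count : ∀ s, 2 * s ≤ n → Nat.card {i // r i = s} = mult n s
  dim : ∑ i, (m i + 1) = 2 ^ n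
  orth : ∀ i k l, k ≤ m i → l ≤ m i → ∑ s, h i k s * h i l s =
    if k = l then (c i : ℂ) * (k.factorial : ℂ) * ((m i - k).factorial : ℂ) else 0
  orth' : ∀ i j, i ≠ j → ∀ k l, k ≤ m i → l ≤ m j → ∑ s, h i k s * h j l s = 0
  inter : ∀ (X : Matrix (Fin 2) (Fin 2) ℂ) i l, l ≤ m i → ∀ s,
    ∑ t, tensorPow n X s t * h i l t
      = ∑ k ∈ Finset.range (m i + 1), h i k s * (X.det ^ r i * Tm X (m i) k l)

def SWData.zero : SWData 0 Unit where
  r _ := 0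
  m _ := 0
  c _ := 1
  h _ _ _ := 1
  hm _ := rfl
  hc _ := one_pos
  real _ _ _ := by simp
  count s hs := by
    obtain rfl : s = 0 := by omega
    simp [mult]
  dim := by simp
  orth i k l hk hl := by
    obtain rfl : k = 0 := by omega
    obtain rfl : l = 0 := by omega
    simp
  orth' i j hij := absurd rfl hij
  inter X i l hl s := by
    obtain rfl : l = 0 := by omega
    simp [tensorPow, Tm]

section

variable {n : ℕ}

/-- symmetric component -/
def vecV (M : ℕ) (h : ℕ → (Fin n → Fin 2) → ℂ) (k : ℕ) : (Fin (n + 1) → Fin 2) → ℂ :=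
  consVec (fun s => (k : ℂ) * h (k - 1) s) (fun s => ((M - k : ℕ) : ℂ) * h k s)

/-- antisymmetric component -/
def vecW (h : ℕ → (Fin n → Fin 2) → ℂ) (k : ℕ) : (Fin (n + 1) → Fin 2) → ℂ :=
  consVec (fun s => h k s) (fun s => - h (k + 1) s)

lemma inner_smul (a b : ℂ) (u v : (Fin n → Fin 2) → ℂ) :
    ∑ s, (a * u s) * (b * v s) = a * b * ∑ s, u s * v s := by
  rw [Finset.mul_sum]; exact Finset.sum_congr rfl fun _ _ => by ring

lemma inner_VV (M M' : ℕ) (h h' : ℕ → (Fin n → Fin 2) → ℂ) (k l : ℕ) :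
    ∑ s, vecV M h k s * vecV M' h' l s = (k : ℂ) * l * ∑ s, h (k - 1) s * h' (l - 1) s
      + ((M - k : ℕ) : ℂ) * ((M' - l : ℕ) : ℂ) * ∑ s, h k s * h' l s := by
  unfold vecV
  rw [consVec_inner, inner_smul, inner_smul]

lemma inner_WW (h h' : ℕ → (Fin n → Fin 2) → ℂ) (k l : ℕ) :
    ∑ s, vecW h k s * vecW h' l s = ∑ s, h k s * h' l s
      + ∑ s, h (k + 1) s * h' (l + 1) s := by
  unfold vecW
  rw [consVec_inner]; simp

lemma inner_VW (M : ℕ) (h h' : ℕ → (Fin n → Fin 2) → ℂ) (k l : ℕ) :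
    ∑ s, vecV M h k s * vecW h' l s = (k : ℂ) * ∑ s, h (k - 1) s * h' l s
      - ((M - k : ℕ) : ℂ) * ∑ s, h k s * h' (l + 1) s := by
  unfold vecV vecW
  rw [consVec_inner, Finset.mul_sum, Finset.mul_sum, sub_eq_add_neg, ← Finset.sum_neg_distrib]
  congr 1 <;> exact Finset.sum_congr rfl fun _ _ => by ring

/-- The zero-coefficient cases. -/
lemma inner_VV_zero (m m' : ℕ) (h h' : ℕ → (Fin n → Fin 2) → ℂ)
    (H : ∀ k l, k ≤ m → l ≤ m' → ∑ s, h k s * h' l s = 0) (k l : ℕ) (hk : k ≤ m + 1)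
    (hl : l ≤ m' + 1) : ∑ s, vecV (m + 1) h k s * vecV (m' + 1) h' l s = 0 := by
  rw [inner_VV, H (k - 1) (l - 1) (by omega) (by omega)]
  rcases Nat.lt_or_ge m k with h1 | h1
  · rw [show m + 1 - k = 0 by omega]; simp
  rcases Nat.lt_or_ge m' l with h2 | h2
  · rw [show m' + 1 - l = 0 by omega]; simp
  rw [H k l h1 h2]; simp

lemma inner_VW_zero (m m' : ℕ) (h h' : ℕ → (Fin n → Fin 2) → ℂ)
    (H : ∀ k l, k ≤ m → l ≤ m' + 1 → ∑ s, h k s * h' l s = 0) (k l : ℕ) (hk : k ≤ m + 1)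
    (hl : l ≤ m') : ∑ s, vecV (m + 1) h k s * vecW h' l s = 0 := by
  rw [inner_VW, H (k - 1) l (by omega) (by omega)]
  rcases Nat.lt_or_ge m k with h1 | h1
  · rw [show m + 1 - k = 0 by omega]; simp
  rw [H k (l + 1) h1 (by omega)]; simp

lemma inner_VW_self (m c : ℕ) (h : ℕ → (Fin n → Fin 2) → ℂ)
    (H : ∀ k l, k ≤ m + 1 → l ≤ m + 1 → ∑ s, h k s * h l s =
      if k = l then (c : ℂ) * (k.factorial : ℂ) * ((m + 1 - k).factorial : ℂ) else 0)
    (k l : ℕ) (hk : k ≤ m + 2)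
    (hl : l ≤ m) : ∑ s, vecV (m + 2) h k s * vecW h l s = 0 := by
  rw [inner_VW, H (k - 1) l (by omega) (by omega)]
  rcases Nat.lt_or_ge (m + 1) k with h1 | h1
  · rw [show m + 2 - k = 0 by omega, if_neg (by omega)]; simp
  rw [H k (l + 1) h1 (by omega)]
  rcases Nat.eq_zero_or_pos k with h2 | h2
  · subst h2; simp
  obtain ⟨k, rfl⟩ : ∃ k', k = k' + 1 := ⟨k - 1, by omega⟩
  by_cases hkl : k = l
  · subst hkl
    obtain ⟨q, rfl⟩ : ∃ q, m = k + q := ⟨m - k, by omega⟩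
    simp only [Nat.add_sub_cancel, if_true]
    rw [show k + q + 1 - k = q + 1 by omega, show k + q + 1 - (k + 1) = q by omega,
      show k + q + 2 - (k + 1) = q + 1 by omega, Nat.factorial_succ, Nat.factorial_succ]
    push_cast; ring
  · rw [if_neg (by omega), if_neg (by omega)]; simp

lemma inner_VV_self (m c : ℕ) (h : ℕ → (Fin n → Fin 2) → ℂ)
    (H : ∀ k l, k ≤ m → l ≤ m → ∑ s, h k s * h l s =
      if k = l then (c : ℂ) * (k.factorial : ℂ) * ((m - k).factorial : ℂ) else 0)
    (k l : ℕ) (hk : k ≤ m + 1) (hl : l ≤ m + 1) :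
    ∑ s, vecV (m + 1) h k s * vecV (m + 1) h l s =
      if k = l then ((c * (m + 1) : ℕ) : ℂ) * (k.factorial : ℂ) * ((m + 1 - k).factorial : ℂ)
      else 0 := by
  rw [inner_VV, H (k - 1) (l - 1) (by omega) (by omega)]
  have h2 : ((m + 1 - k : ℕ) : ℂ) * ((m + 1 - l : ℕ) : ℂ) * ∑ s, h k s * h l s
     = ((m + 1 - k : ℕ) : ℂ) * ((m + 1 - l : ℕ) : ℂ) *
      if k = l then (c : ℂ) * (k.factorial : ℂ) * ((m - k).factorial : ℂ) else 0 := by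
    rcases Nat.lt_or_ge m k with h1 | h1
    · rw [show m + 1 - k = 0 by omega]; simp
    rcases Nat.lt_or_ge m l with h2 | h2
    · rw [show m + 1 - l = 0 by omega]; simp
    rw [H k l h1 h2]
  rw [h2]
  by_cases hkl : k = l
  · subst hkl
    simp only [if_true]
    obtain ⟨q, hq⟩ : ∃ q, m + 1 = k + q := ⟨m + 1 - k, by omega⟩
    rw [hq, show m - (k - 1) = m - (k - 1) from rfl, show k + q - k = q by omega]
    have hq' : (m : ℂ) + 1 = k + q := by exact_mod_cast hq
    have e1 : (k : ℂ) * k * (c * ((k - 1).factorial : ℂ) * ((m - (k - 1)).factorial : ℂ))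
        = k * (c * (k.factorial : ℂ) * (q.factorial : ℂ)) := by
      cases k with
      | zero => simp
      | succ k =>
        rw [show m - (k + 1 - 1) = q by omega, Nat.factorial_succ k]
        simp only [Nat.add_sub_cancel]
        push_cast; ring
    have e2 : (q : ℂ) * q * (c * (k.factorial : ℂ) * ((m - k).factorial : ℂ))
        = q * (c * (k.factorial : ℂ) * (q.factorial : ℂ)) := by
      cases q with
      | zero => simp
      | succ q =>
        rw [show m - k = q by omega, Nat.factorial_succ q]
        push_cast; ring
    rw [e1, e2]; push_cast; ring
  · rw [if_neg hkl, if_neg hkl]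
    rcases Nat.eq_zero_or_pos k with h3 | h3
    · subst h3; simp
    rcases Nat.eq_zero_or_pos l with h4 | h4
    · subst h4; simp
    rw [if_neg (by omega)]; simp

lemma inner_WW_self (m c : ℕ) (h : ℕ → (Fin n → Fin 2) → ℂ)
    (H : ∀ k l, k ≤ m + 1 → l ≤ m + 1 → ∑ s, h k s * h l s =
      if k = l then (c : ℂ) * (k.factorial : ℂ) * ((m + 1 - k).factorial : ℂ) else 0)
    (k l : ℕ) (hk : k ≤ m) (hl : l ≤ m) :
    ∑ s, vecW h k s * vecW h l s =
      if k = l then ((c * (m + 2) : ℕ) : ℂ) * (k.factorial : ℂ) * ((m - k).factorial : ℂ)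
      else 0 := by
  rw [inner_WW, H k l (by omega) (by omega), H (k + 1) (l + 1) (by omega) (by omega)]
  by_cases hkl : k = l
  · subst hkl
    simp only [if_true]
    obtain ⟨q, rfl⟩ : ∃ q, m = k + q := ⟨m - k, by omega⟩
    rw [show k + q + 1 - k = q + 1 by omega, show k + q + 1 - (k + 1) = q by omega,
      show k + q - k = q by omega, Nat.factorial_succ, Nat.factorial_succ]
    push_cast; ring
  · rw [if_neg hkl, if_neg hkl, if_neg (by omega)]; simp

lemma inter_V (X : Matrix (Fin 2) (Fin 2) ℂ) (m : ℕ) (D : ℂ) (h : ℕ → (Fin n → Fin 2) → ℂ)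
    (H : ∀ l, l ≤ m → ∀ s, ∑ t, tensorPow n X s t * h l t
      = ∑ k ∈ Finset.range (m + 1), h k s * (D * Tm X m k l))
    (l : ℕ) (hl : l ≤ m + 1) (s : Fin (n + 1) → Fin 2) :
    ∑ t, tensorPow (n + 1) X s t * vecV (m + 1) h l t
      = ∑ k ∈ Finset.range (m + 1 + 1), vecV (m + 1) h k s * (D * Tm X (m + 1) k l) := by
  obtain ⟨b, s, rfl⟩ : ∃ (b : Fin 2) (s' : Fin n → Fin 2), s = Fin.cons b s' :=
    ⟨s 0, Fin.tail s, (Fin.cons_self_tail s).symm⟩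
  unfold vecV
  rw [tensorPow_consVec]
  have e1 : ∑ t, tensorPow n X s t * ((l : ℂ) * h (l - 1) t)
      = l * ∑ k ∈ Finset.range (m + 1), h k s * (D * Tm X m k (l - 1)) := by
    rw [← H (l - 1) (by omega) s, Finset.mul_sum]
    exact Finset.sum_congr rfl fun _ _ => by ring
  have e2 : ∑ t, tensorPow n X s t * (((m + 1 - l : ℕ) : ℂ) * h l t)
      = ((m + 1 - l : ℕ) : ℂ) * ∑ k ∈ Finset.range (m + 1), h k s * (D * Tm X m k l) := by
    rcases Nat.lt_or_ge m l with h1 | h1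
    · rw [show m + 1 - l = 0 by omega]; simp
    rw [← H l h1 s, Finset.mul_sum]
    exact Finset.sum_congr rfl fun _ _ => by ring
  rw [e1, e2]
  simp only [Finset.mul_sum]
  rw [← Finset.sum_add_distrib]
  match b with
  | 0 =>
    rw [Finset.sum_range_succ' _ (m + 1)]
    simp only [consVec_zero, Nat.add_sub_cancel]
    rw [Nat.cast_zero, zero_mul, zero_mul, add_zero]
    refine Finset.sum_congr rfl fun k _ => ?_
    have := Tm_V0 X m k l hl
    push_cast
    linear_combination (h k s * D) * this
  | 1 =>
    rw [Finset.sum_range_succ _ (m + 1)]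
    simp only [consVec_one, Nat.sub_self]
    rw [Nat.cast_zero, zero_mul, zero_mul, add_zero]
    refine Finset.sum_congr rfl fun k hk => ?_
    have := Tm_V1 X m k l hl (by have := Finset.mem_range.1 hk; omega)
    linear_combination (h k s * D) * this

lemma inter_W (X : Matrix (Fin 2) (Fin 2) ℂ) (m : ℕ) (D : ℂ) (h : ℕ → (Fin n → Fin 2) → ℂ)
    (H : ∀ l, l ≤ m + 1 → ∀ s, ∑ t, tensorPow n X s t * h l t
      = ∑ k ∈ Finset.range (m + 1 + 1), h k s * (D * Tm X (m + 1) k l))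
    (l : ℕ) (hl : l ≤ m) (s : Fin (n + 1) → Fin 2) :
    ∑ t, tensorPow (n + 1) X s t * vecW h l t
      = ∑ k ∈ Finset.range (m + 1), vecW h k s * (D * X.det * Tm X m k l) := by
  obtain ⟨b, s, rfl⟩ : ∃ (b : Fin 2) (s' : Fin n → Fin 2), s = Fin.cons b s' :=
    ⟨s 0, Fin.tail s, (Fin.cons_self_tail s).symm⟩
  unfold vecW
  rw [tensorPow_consVec, H l (by omega) s]
  simp only [mul_neg]
  rw [Finset.sum_neg_distrib, H (l + 1) (by omega) s, mul_neg, ← sub_eq_add_neg,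
    Finset.mul_sum, Finset.mul_sum, ← Finset.sum_sub_distrib]
  match b with
  | 0 =>
    simp only [consVec_zero]
    rw [Finset.sum_range_succ]
    have h0 := Tm_W0 X m (m + 1) l hl
    rw [Tm_zero X m (m + 1) l hl (by omega)] at h0
    have : X 0 0 * (h (m + 1) s * (D * Tm X (m + 1) (m + 1) l)) -
        X 0 1 * (h (m + 1) s * (D * Tm X (m + 1) (m + 1) (l + 1))) = 0 := by
      linear_combination (h (m + 1) s * D) * h0
    rw [this, add_zero]
    refine Finset.sum_congr rfl fun k _ => ?_
    have := Tm_W0 X m k l hl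
    linear_combination (h k s * D) * this
  | 1 =>
    simp only [consVec_one]
    rw [Finset.sum_range_succ']
    have h0 := Tm_W1 X m 0 l hl
    simp only [if_true] at h0
    have : X 1 0 * (h 0 s * (D * Tm X (m + 1) 0 l)) -
        X 1 1 * (h 0 s * (D * Tm X (m + 1) 0 (l + 1))) = 0 := by
      linear_combination (h 0 s * D) * h0
    rw [this, add_zero]
    refine Finset.sum_congr rfl fun k _ => ?_
    have := Tm_W1 X m (k + 1) l hl
    simp only [Nat.add_sub_cancel, if_neg (Nat.succ_ne_zero k)] at this
    linear_combination (h (k + 1) s * D) * this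

lemma star_consVec (u v : (Fin n → Fin 2) → ℂ) (hu : ∀ s, star (u s) = u s)
    (hv : ∀ s, star (v s) = v s) (s) : star (consVec u v s) = consVec u v s := by
  unfold consVec; split_ifs <;> simp_all

open Classical in
def SWData.succ {ι : Type} [Fintype ι] (S : SWData n ι) :
    SWData (n + 1) (ι ⊕ {i : ι // 0 < S.m i}) where
  r := Sum.elim S.r (fun i => S.r i + 1)
  m := Sum.elim (fun i => S.m i + 1) (fun i => S.m i - 1)
  c := Sum.elim (fun i => S.c i * (S.m i + 1)) (fun i => S.c i * (S.m i + 1))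
  h := Sum.elim (fun i => vecV (S.m i + 1) (S.h i)) (fun i => vecW (S.h i))
  hm := by
    rintro (i | ⟨i, hi⟩)
    · have := S.hm i; simp; omega
    · have := S.hm i; simp; omega
  hc := by
    rintro (i | ⟨i, hi⟩)
    · have := S.hc i; simp; omega
    · have := S.hc i; simp; omega
  real := by
    rintro (i | ⟨i, hi⟩) k s
    · refine star_consVec (fun s => (k : ℂ) * S.h i (k - 1) s)
        (fun s => ((S.m i + 1 - k : ℕ) : ℂ) * S.h i k s) (fun s => ?_) (fun s => ?_) s
      · rw [star_mul', S.real, star_natCast]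
      · rw [star_mul', S.real, star_natCast]
    · exact star_consVec _ _ (fun s => S.real _ _ _) (fun s => by rw [star_neg, S.real]) s
  count := by
    intro s hs
    rw [Nat.card_congr (Equiv.subtypeSum)]
    simp only [Sum.elim_inl, Sum.elim_inr]
    rw [Nat.card_sum]
    cases s with
    | zero =>
      rw [S.count 0 (by omega)]
      simp [mult_zero']
    | succ s =>
      rw [mult_succ n s (by omega)]
      congr 1
      · rcases Nat.lt_or_ge n (2 * (s + 1)) with h1 | h1
        · obtain rfl : n = 2 * s + 1 := by omega
          rw [mult_half]
          have : IsEmpty {i // S.r i = s + 1} := ⟨fun i => by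
            have := S.hm i.1; have := i.2; omega⟩
          simp
        · exact S.count _ h1
      · rw [← S.count s (by omega)]
        refine Nat.card_congr ⟨fun i => ⟨i.1.1, by have := i.2; omega⟩,
          fun i => ⟨⟨i.1, by have := i.2; have := S.hm i.1; omega⟩, by have := i.2; simp; omega⟩,
          fun i => rfl, fun i => rfl⟩
  dim := by
    rw [Fintype.sum_sum_type]
    simp only [Sum.elim_inl, Sum.elim_inr]
    have : ∑ x : {i : ι // 0 < S.m i}, (S.m x - 1 + 1) = ∑ i, S.m i := by
      rw [Finset.sum_congr rfl (fun (x : {i : ι // 0 < S.m i}) _ =>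
        show S.m x - 1 + 1 = S.m x from by have := x.2; omega)]
      rw [← Finset.sum_subtype (Finset.univ.filter (fun i => 0 < S.m i)) (by simp) S.m,
        Finset.sum_filter]
      refine Finset.sum_congr rfl fun i _ => ?_
      split_ifs <;> omega
    rw [this, ← Finset.sum_add_distrib, pow_succ, ← S.dim, Finset.sum_mul]
    exact Finset.sum_congr rfl fun _ _ => by ring
  orth := by
    rintro (i | ⟨i, hi⟩) k l hk hl
    · exact inner_VV_self _ _ _ (S.orth i) k l hk hl
    · obtain ⟨q, hq⟩ : ∃ q, S.m i = q + 1 := ⟨S.m i - 1, by omega⟩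
      have := S.orth i
      simp only [Sum.elim_inr, hq, Nat.add_sub_cancel] at *
      exact inner_WW_self _ _ _ this k l hk hl
  orth' := by
    have hVW : ∀ (i : ι) (j : {i : ι // 0 < S.m i}) (k l : ℕ), k ≤ S.m i + 1 → l ≤ S.m j - 1 →
        ∑ s, vecV (S.m i + 1) (S.h i) k s * vecW (S.h j) l s = 0 := by
      rintro i ⟨j, hj⟩ k l hk hl
      obtain ⟨q, hq⟩ : ∃ q, S.m j = q + 1 := ⟨S.m j - 1, by omega⟩
      by_cases hij : i = j
      · subst hij
        have := S.orth i
        simp only [hq, Nat.add_sub_cancel] at *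
        exact inner_VW_self _ _ _ this k l hk hl
      · have := S.orth' i j hij
        simp only [hq, Nat.add_sub_cancel] at *
        exact inner_VW_zero _ _ _ _ this k l hk hl
    rintro (i | i) (j | j) hij k l hk hl
    · exact inner_VV_zero _ _ _ _ (S.orth' i j (by simpa using hij)) k l hk hl
    · exact hVW i j k l hk hl
    · simp only [Sum.elim_inl, Sum.elim_inr] at *
      rw [← hVW j i l k hl hk]
      exact Finset.sum_congr rfl fun _ _ => mul_comm _ _
    · have hne : (i : ι) ≠ j := fun h => hij (by rw [Subtype.ext h])
      have hi := i.2
      have hj := j.2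
      simp only [Sum.elim_inr] at *
      rw [inner_WW, S.orth' i j hne k l (by omega) (by omega),
        S.orth' i j hne (k + 1) (l + 1) (by omega) (by omega), add_zero]
  inter := by
    rintro X (i | ⟨i, hi⟩) l hl s
    · exact inter_V X _ _ _ (S.inter X i) l hl s
    · obtain ⟨q, hq⟩ : ∃ q, S.m i = q + 1 := ⟨S.m i - 1, by omega⟩
      have := S.inter X i
      simp only [Sum.elim_inr, hq, Nat.add_sub_cancel, pow_succ] at *
      exact inter_W X _ _ _ this l hl s

lemma exists_SWData (n : ℕ) : ∃ (ι : Type) (_ : Fintype ι), Nonempty (SWData n ι) := by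
  classical
  induction n with
  | zero => exact ⟨Unit, inferInstance, ⟨SWData.zero⟩⟩
  | succ n ih =>
    obtain ⟨ι, _, ⟨S⟩⟩ := ih
    exact ⟨_, _, ⟨S.succ⟩⟩

end

lemma SWData.sandwich {n : ℕ} {ι : Type} [Fintype ι] [DecidableEq ι] (S : SWData n ι)
    (X : Matrix (Fin 2) (Fin 2) ℂ) (i j : ι) (k l : ℕ) (hk : k ≤ S.m i) (hl : l ≤ S.m j) :
    ∑ s, S.h i k s * ∑ t, tensorPow n X s t * S.h j l t
      = if i = j then ((S.c i : ℂ) * (k.factorial : ℂ) * ((S.m i - k).factorial : ℂ)) *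
        (X.det ^ S.r i * Tm X (S.m i) k l) else 0 := by
  have e : ∀ s, S.h i k s * ∑ t, tensorPow n X s t * S.h j l t
      = ∑ k' ∈ Finset.range (S.m j + 1),
        (S.h i k s * S.h j k' s) * (X.det ^ S.r j * Tm X (S.m j) k' l) := by
    intro s
    rw [S.inter X j l hl s, Finset.mul_sum]
    exact Finset.sum_congr rfl fun _ _ => by ring
  simp only [e]
  rw [Finset.sum_comm]
  simp only [← Finset.sum_mul]
  split_ifs with hij
  · subst hij
    rw [Finset.sum_eq_single k]
    · rw [S.orth i k k hk hk, if_pos rfl]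
    · intro b hb hbk
      rw [S.orth i k b hk (by have := Finset.mem_range.1 hb; omega), if_neg (Ne.symm hbk), zero_mul]
    · intro h
      exact absurd (Finset.mem_range.2 (by omega)) h
  · refine Finset.sum_eq_zero fun b hb => ?_
    rw [S.orth' i j hij k b hk (by have := Finset.mem_range.1 hb; omega), zero_mul]

instance (n : ℕ) : Fintype (SWIndex n) :=
  inferInstanceAs (Fintype (Σ r : Fin (n / 2 + 1), Fin (n - 2 * (r : ℕ) + 1) × Fin (mult n (r : ℕ))))

lemma card_SWIndex (n : ℕ) : Fintype.card (SWIndex n) =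
    ∑ r ∈ Finset.range (n / 2 + 1), (n - 2 * r + 1) * mult n r := by
  have : Fintype.card (SWIndex n) = Fintype.card
    (Σ r : Fin (n / 2 + 1), Fin (n - 2 * (r : ℕ) + 1) × Fin (mult n (r : ℕ))) := rfl
  rw [this, Fintype.card_sigma, Finset.sum_range]
  simp

lemma SWData.sum_mult {n : ℕ} {ι : Type} [Fintype ι] (S : SWData n ι) :
    ∑ r ∈ Finset.range (n / 2 + 1), (n - 2 * r + 1) * mult n r = 2 ^ n := by
  classical
  rw [← S.dim, ← Finset.sum_fiberwise_of_maps_to (s := Finset.univ) (g := S.r)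
    (t := Finset.range (n / 2 + 1)) (fun i _ => by
      have := S.hm i; simp; omega)]
  refine Finset.sum_congr rfl fun r hr => ?_
  have hr' := Finset.mem_range.1 hr
  rw [← S.count r (by omega), Nat.card_eq_fintype_card, Fintype.card_subtype]
  rw [Finset.sum_congr rfl (g := fun _ => n - 2 * r + 1), Finset.sum_const, smul_eq_mul, mul_comm]
  intro i hi
  have := S.hm i
  have := (Finset.mem_filter.1 hi).2
  omega

/-- Schur-Weyl decomposition of `(ℂ²)^{⊗n}`: a single unitary and reindexing bijection
simultaneously block-diagonalize all tensor powers `X^{⊗n}`, with blocks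
`(det X)^r • S_{n-2r}(X)` of multiplicity `C(n,r) − C(n,r−1)`; in particular
`Σ_r (n−2r+1)(C(n,r) − C(n,r−1)) = 2ⁿ`. -/
theorem stmt1 (n : ℕ) (hn : 1 ≤ n) :
    ∃ (U : Matrix (Fin n → Fin 2) (Fin n → Fin 2) ℂ) (e : SWIndex n ≃ (Fin n → Fin 2)),
      U * Uᴴ = 1 ∧ Uᴴ * U = 1 ∧
      (∀ X : Matrix (Fin 2) (Fin 2) ℂ,
        Matrix.reindex e.symm e.symm (U * tensorPow n X * Uᴴ) = blockMat n X) ∧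
      ∑ r ∈ Finset.range (n / 2 + 1), (n - 2 * r + 1) * mult n r = 2 ^ n := by

  classical
  obtain ⟨ι, _, ⟨S⟩⟩ := exists_SWData n
  have hsum := S.sum_mult
  have hcard : Fintype.card (SWIndex n) = Fintype.card (Fin n → Fin 2) := by
    rw [card_SWIndex, hsum]; simp
  let e : SWIndex n ≃ (Fin n → Fin 2) := Fintype.equivOfCardEq hcard
  have hg : ∀ r : Fin (n / 2 + 1), Nonempty (Fin (mult n r) ≃ {i // S.r i = (r : ℕ)}) := fun r =>
    ⟨(Finite.equivFinOfCardEq (S.count r (by have := r.2; omega))).symm⟩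
  let g := fun r => (hg r).some
  let idx : SWIndex n → ι := fun p => (g p.1 p.2.2).1
  have hidx_r : ∀ p, S.r (idx p) = (p.1 : ℕ) := fun p => (g p.1 p.2.2).2
  have hidx_m : ∀ p, S.m (idx p) = n - 2 * (p.1 : ℕ) := fun p => by
    have := S.hm (idx p); have := hidx_r p; omega
  have hk : ∀ p : SWIndex n, (p.2.1 : ℕ) ≤ S.m (idx p) := fun p => by
    have h1 := p.2.1.2
    have := hidx_m p; omega
  have hidx : ∀ p q, idx p = idx q ↔ p.1 = q.1 ∧ (p.2.2 : ℕ) = (q.2.2 : ℕ) := by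
    intro p q
    constructor
    · intro h
      have h1 : p.1 = q.1 := Fin.ext (by rw [← hidx_r p, ← hidx_r q, h])
      obtain ⟨r, k, x⟩ := p
      obtain ⟨r', l, y⟩ := q
      obtain rfl : r = r' := h1
      have h2 : g r x = g r y := Subtype.ext h
      exact ⟨rfl, by rw [(g r).injective h2]⟩
    · rintro ⟨h1, h2⟩
      obtain ⟨r, k, x⟩ := p
      obtain ⟨r', l, y⟩ := q
      obtain rfl : r = r' := h1
      obtain rfl : x = y := Fin.ext h2
      rfl
  let N : SWIndex n → ℝ := fun p => Real.sqrt ((S.c (idx p) : ℝ) *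
    (((p.2.1 : ℕ).factorial : ℝ) * ((n - 2 * (p.1 : ℕ) - (p.2.1 : ℕ)).factorial : ℝ)))
  have hNarg : ∀ p, 0 < ((S.c (idx p) : ℝ) *
    (((p.2.1 : ℕ).factorial : ℝ) * ((n - 2 * (p.1 : ℕ) - (p.2.1 : ℕ)).factorial : ℝ))) := fun p => by
      have := S.hc (idx p)
      positivity
  have hN : ∀ p, 0 < N p := fun p => Real.sqrt_pos.2 (hNarg p)
  have hN0 : ∀ p, (N p : ℂ) ≠ 0 := fun p => by exact_mod_cast (hN p).ne'
  have hN2 : ∀ p, (N p : ℂ) * N p = (S.c (idx p) : ℂ) * ((p.2.1 : ℕ).factorial : ℂ) *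
      ((S.m (idx p) - (p.2.1 : ℕ)).factorial : ℂ) := fun p => by
    rw [hidx_m, mul_assoc]
    have h : N p * N p = _ := Real.mul_self_sqrt (hNarg p).le
    exact_mod_cast congrArg (fun x : ℝ => (x : ℂ)) h
  let f : SWIndex n → (Fin n → Fin 2) → ℂ := fun p s => (N p : ℂ)⁻¹ * S.h (idx p) p.2.1 s
  have hf : ∀ p s, star (f p s) = f p s := fun p s => by
    simp only [f]
    rw [star_mul', S.real, star_inv₀]
    simp
  let U : Matrix (Fin n → Fin 2) (Fin n → Fin 2) ℂ := Matrix.of fun s t => f (e.symm s) t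
  have hU : U * Uᴴ = 1 := by
    ext a b
    rw [Matrix.mul_apply]
    simp only [Matrix.conjTranspose_apply, U, Matrix.of_apply, hf]
    set p := e.symm a with hp
    set q := e.symm b with hq
    have hab : a = b ↔ p = q := by simp [hp, hq]
    simp only [f]
    rw [inner_smul, Matrix.one_apply]
    by_cases hi : idx p = idx q
    · have h1 := S.orth (idx p) p.2.1 q.2.1 (hk p) (by rw [hi]; exact hk q)
      rw [← hi, h1]
      by_cases hkl : (p.2.1 : ℕ) = (q.2.1 : ℕ)
      · have hpq : p = q := by
          obtain ⟨h1, h2⟩ := (hidx p q).1 hi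
          clear_value p q
          obtain ⟨r, k, x⟩ := p
          obtain ⟨r', l, y⟩ := q
          obtain rfl : r = r' := h1
          obtain rfl : x = y := Fin.ext h2
          obtain rfl : k = l := Fin.ext hkl
          rfl
        rw [if_pos hkl, if_pos (hab.2 hpq), ← hN2 p, ← hpq]
        have := hN0 p
        field_simp
      · rw [if_neg hkl, mul_zero, if_neg]
        rw [hab]
        intro h
        exact hkl (by rw [h])
    · rw [S.orth' _ _ hi _ _ (hk p) (hk q), mul_zero, if_neg]
      rw [hab]
      intro h
      exact hi (by rw [h])
  refine ⟨U, e, hU, mul_eq_one_comm.1 hU, ?_, hsum⟩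
  intro X
  ext p q
  rw [Matrix.reindex_apply, Matrix.submatrix_apply, Equiv.symm_symm, Matrix.mul_assoc,
    Matrix.mul_apply]
  simp only [Matrix.mul_apply, Matrix.conjTranspose_apply, U, Matrix.of_apply, hf,
    Equiv.symm_apply_apply]
  have e1 : ∑ s, f p s * ∑ t, tensorPow n X s t * f q t
      = (N p : ℂ)⁻¹ * (N q : ℂ)⁻¹ * ∑ s, S.h (idx p) p.2.1 s *
        ∑ t, tensorPow n X s t * S.h (idx q) q.2.1 t := by
    simp only [f, Finset.mul_sum]
    exact Finset.sum_congr rfl fun _ _ => Finset.sum_congr rfl fun _ _ => by ring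
  rw [e1, S.sandwich X _ _ _ _ (hk p) (hk q)]
  unfold blockMat
  by_cases h1 : p.1 = q.1
  · by_cases h2 : (p.2.2 : ℕ) = (q.2.2 : ℕ)
    · rw [if_pos ((hidx p q).2 ⟨h1, h2⟩), dif_pos h1, if_pos h2, Sm_eq, ← hN2 p, hidx_r, hidx_m]
      have hs : (Real.sqrt ((Nat.factorial (p.2.1 : ℕ) *
          Nat.factorial (n - 2 * (p.1 : ℕ) - (p.2.1 : ℕ)) : ℝ) /
          (Nat.factorial (q.2.1 : ℕ) * Nat.factorial (n - 2 * (p.1 : ℕ) - (q.2.1 : ℕ))))) =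
          N p / N q := by
        simp only [N]
        rw [← Real.sqrt_div (hNarg p).le, (hidx p q).2 ⟨h1, h2⟩,
          show n - 2 * (q.1 : ℕ) - (q.2.1 : ℕ) = n - 2 * (p.1 : ℕ) - (q.2.1 : ℕ) from
            congrArg (fun r : Fin (n / 2 + 1) => n - 2 * (r : ℕ) - (q.2.1 : ℕ)) h1.symm]
        congr 1
        rw [mul_div_mul_left]
        exact_mod_cast (S.hc (idx q)).ne'
      simp only [Fin.val_cast]
      rw [hs]
      have := hN0 p
      have := hN0 q
      push_cast
      field_simp
    · rw [dif_pos h1, if_neg h2, if_neg (fun h => h2 ((hidx p q).1 h).2), mul_zero]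
  · rw [dif_neg h1, if_neg (fun h => h1 ((hidx p q).1 h).1), mul_zero]

end
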